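/- Let ω be an effective n-form on ℝ^{2n+1} whose Monge–Ampère operator is of first order, in the sense that there exists a smooth function F on ℝ^{2n+1} such that (j¹φ)*ω = (F ∘ j¹φ)·β for every smooth φ: ℝⁿ → ℝ. Then ω = L·β for some smooth function L on ℝ^{2n+1} (indeed ω = F·β). In other words, every effective first-order Lagrangian n-form is of the form L·dq¹∧…∧dqⁿ. -/

import Mathlib

noncomputable section

namespace MA

/-- Points / tangent vectors of ℝ^m. -/
abbrev Vec (m : ℕ) := Fin m → ℝ

/-- An (unbundled) differential `k`-form on ℝ^m : at each point it eats a
`k`-tuple of tangent vectors and returns a real number. -/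
abbrev Form (m k : ℕ) := Vec m → (Fin k → Vec m) → ℝ

/-- `ω` is pointwise an alternating multilinear map, i.e. a genuine exterior form. -/
def IsForm {m k : ℕ} (ω : Form m k) : Prop :=
  ∀ x : Vec m, ∃ a : AlternatingMap ℝ (Vec m) ℝ (Fin k), ∀ v, ω x v = a v

/-- Smoothness of a differential form (smoothness of all coefficients). -/
def SmoothForm {m k : ℕ} (ω : Form m k) : Prop :=
  ∀ v : Fin k → Vec m, ContDiff ℝ (⊤ : ℕ∞) fun x => ω x v

/-- Multiplication of a form by a scalar function. -/
def fsmul {m k : ℕ} (f : Vec m → ℝ) (ω : Form m k) : Form m k := fun x v => f x * ω x v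

/-- Wedge (exterior) product of differential forms. -/
def wedge {m k l : ℕ} (ω : Form m k) (η : Form m l) : Form m (k + l) := fun x v =>
  ((k.factorial * l.factorial : ℕ) : ℝ)⁻¹ *
    ∑ σ : Equiv.Perm (Fin (k + l)),
      ((Equiv.Perm.sign σ : ℤ) : ℝ) *
        (ω x fun i => v (σ (Fin.castAdd l i))) *
        (η x fun j => v (σ (Fin.natAdd k j)))

/-- Interior product (contraction) of a form with a (constant) vector. -/
def iprod {m : ℕ} (u : Vec m) : ∀ {k : ℕ}, Form m k → Form m (k - 1)
  | 0, _ => 0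
  | _ + 1, ω => fun x v => ω x (Fin.cons u v)

/-- Exterior derivative of a differential form (coordinate formula). -/
def exd {m k : ℕ} (ω : Form m k) : Form m (k + 1) := fun x v =>
  ∑ i : Fin (k + 1),
    (-1 : ℝ) ^ (i : ℕ) * fderiv ℝ (fun y => ω y fun j => v (i.succAbove j)) x (v i)

/-- Change the (propositionally equal) degree of a form. -/
def reindex {m k l : ℕ} (h : k = l) (ω : Form m k) : Form m l :=
  fun x v => ω x fun i => v (Fin.cast h i)

/-- Pullback of a differential form along a map. -/
def pullback {a b k : ℕ} (f : Vec a → Vec b) (ω : Form b k) : Form a k :=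
  fun x v => ω (f x) fun i => fderiv ℝ f x (v i)

/-- `i`-th standard basis vector of ℝ^m. -/
def basisVec {m : ℕ} (i : Fin m) : Vec m := Pi.single i 1

/-- The coordinate 1-form `dx^i`. -/
def dx {m : ℕ} (i : Fin m) : Form m 1 := fun _ v => v 0 i

/-- Partial derivative of a function in the `i`-th coordinate direction. -/
def pd {m : ℕ} (i : Fin m) (f : Vec m → ℝ) : Vec m → ℝ := fun x => fderiv ℝ f x (basisVec i)

/- Jet-space coordinates on J¹ℝⁿ = ℝ^{2n+1} : (q¹,…,qⁿ,u,p₁,…,pₙ). -/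

/-- Index of the coordinate `q^μ`. -/
def qIdx {n : ℕ} (μ : Fin n) : Fin (2 * n + 1) := ⟨μ, by have := μ.isLt; omega⟩

/-- Index of the coordinate `u`. -/
def uIdx {n : ℕ} : Fin (2 * n + 1) := ⟨n, by omega⟩

/-- Index of the coordinate `p_μ`. -/
def pIdx {n : ℕ} (μ : Fin n) : Fin (2 * n + 1) := ⟨n + 1 + μ, by have := μ.isLt; omega⟩

/-- The Reeb field `χ = ∂/∂u` (a constant vector field). -/
def chi {n : ℕ} : Vec (2 * n + 1) := basisVec uIdx

/-- The standard contact form `c = du - Σ p_μ dq^μ` on J¹ℝⁿ. -/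
def contact {n : ℕ} : Form (2 * n + 1) 1 := fun x v =>
  v 0 uIdx - ∑ μ : Fin n, x (pIdx μ) * v 0 (qIdx μ)

/-- The symplectic-type 2-form `Ω = dc = Σ dq^μ ∧ dp_μ`. -/
def symp {n : ℕ} : Form (2 * n + 1) 2 := ∑ μ : Fin n, wedge (dx (qIdx μ)) (dx (pIdx μ))

/-- The bottom operator `⊥ = Σ_μ ∂_{p_μ} ⌟ ∂_{q^μ} ⌟ ·` (zero on forms of degree ≤ 1). -/
def botOp {n k : ℕ} (ω : Form (2 * n + 1) k) : Form (2 * n + 1) (k - 2) :=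
  ∑ μ : Fin n, iprod (basisVec (pIdx μ)) (iprod (basisVec (qIdx μ)) ω)

/-- A form is effective if it is killed by `χ ⌟ ·` and by `⊥`. -/
def Effective {n k : ℕ} (ω : Form (2 * n + 1) k) : Prop :=
  iprod (chi (n := n)) ω = 0 ∧ botOp ω = 0

/-- The projection `p(α) = α - c ∧ (χ ⌟ α)` onto forms annihilated by `χ ⌟ ·`. -/
def proj {n : ℕ} : ∀ {k : ℕ}, Form (2 * n + 1) k → Form (2 * n + 1) k
  | 0, α => α
  | j + 1, α => α - reindex (Nat.add_comm 1 j) (wedge contact (iprod (chi (n := n)) α))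

/-- The projected exterior derivative `d_p = p ∘ d`. -/
def dproj {n k : ℕ} (ω : Form (2 * n + 1) k) : Form (2 * n + 1) (k + 1) := proj (exd ω)

/-- Lie derivative along the (constant) Reeb field `χ`. -/
def lieChi {n k : ℕ} (ω : Form (2 * n + 1) k) : Form (2 * n + 1) k := fun x v =>
  fderiv ℝ (fun y => ω y v) x (chi (n := n))

/-- The Euler operator `E = d_p ∘ ⊥ ∘ d_p + L_χ` on n-forms over J¹ℝⁿ. -/
def euler : ∀ {n : ℕ}, Form (2 * n + 1) n → Form (2 * n + 1) n
  | 0, ω => lieChi ω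
  | n + 1, ω =>
    reindex (show n + 1 + 1 - 2 + 1 = n + 1 by omega) (dproj (botOp (dproj ω))) + lieChi ω

/-- The horizontal volume form `β = dq¹ ∧ … ∧ dqⁿ` on J¹ℝⁿ. -/
def qvol {n : ℕ} : Form (2 * n + 1) n := fun _ v =>
  Matrix.det (Matrix.of fun i j : Fin n => v i (qIdx j))

/-- The volume form `β = dq¹ ∧ … ∧ dqⁿ` on the base ℝⁿ. -/
def baseVol {n : ℕ} : Form n n := fun _ v => Matrix.det (Matrix.of fun i j : Fin n => v i j)

/-- `β_μ = ∂_{q^μ} ⌟ β`. -/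
def betaMu {n : ℕ} (μ : Fin n) : Form (2 * n + 1) (n - 1) := iprod (basisVec (qIdx μ)) qvol

/-- The first jet prolongation `j¹φ : ℝⁿ → ℝ^{2n+1}`, `x ↦ (x, φ(x), ∂₁φ(x), …, ∂ₙφ(x))`. -/
def jet {n : ℕ} (φ : Vec n → ℝ) (x : Vec n) : Vec (2 * n + 1) := fun i =>
  if h : (i : ℕ) < n then x ⟨i, h⟩
  else if h2 : (i : ℕ) = n then φ x
  else fderiv ℝ φ x (basisVec ⟨(i : ℕ) - (n + 1), by have := i.isLt; omega⟩)

/-- Second partial derivative `φ_{μν} = ∂²φ/∂q^μ∂q^ν`. -/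
def d2 {n : ℕ} (φ : Vec n → ℝ) (μ ν : Fin n) : Vec n → ℝ := fun x =>
  fderiv ℝ (fun y => fderiv ℝ φ y (basisVec ν)) x (basisVec μ)

/-- A form is multisymplectic if it is closed and pointwise nondegenerate. -/
def Multisymplectic {m k : ℕ} (μ : Form m k) : Prop :=
  exd μ = 0 ∧ ∀ (x v : Vec m), iprod v μ x = 0 → v = 0

/-- Lift a form on J¹ℝⁿ = ℝ^{2n+1} to ℝ^{2n+2} = J¹ℝⁿ × ℝ (extra coordinate `e`)
along the projection. -/
def liftForm {n k : ℕ} (ω : Form (2 * n + 1) k) : Form (2 * n + 1 + 1) k :=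
  pullback (fun y (i : Fin (2 * n + 1)) => y i.castSucc) ω

/-- The 1-form `de` on ℝ^{2n+2}. -/
def deForm {n : ℕ} : Form (2 * n + 1 + 1) 1 := dx (Fin.last (2 * n + 1))

/-- The (n+1)-form `m_ω = de ∧ β + c ∧ ω` on ℝ^{2n+2}. -/
def msf {n : ℕ} (ω : Form (2 * n + 1) n) : Form (2 * n + 1 + 1) (n + 1) :=
  reindex (Nat.add_comm 1 n) (wedge (deForm (n := n)) (liftForm qvol)) +
    reindex (Nat.add_comm 1 n) (wedge (liftForm (contact (n := n))) (liftForm ω))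

section Frames

open Function

variable {ι V : Type*} [DecidableEq ι] [AddCommGroup V] [Module ℝ V]

lemma AlternatingMap.map_update_add_smul (b : V [⋀^ι]→ₗ[ℝ] ℝ) (v : ι → V) {i j : ι}
    (hij : i ≠ j) (r : ℝ) : b (update v i (v i + r • v j)) = b v := by
  rw [b.map_update_add, b.map_update_smul, b.map_update_self v hij, update_eq_self]
  simp

variable [Fintype ι]

/-- `b` vanishes on every graph `e i + ∑ j, A i j • f j` with `A` symmetric. -/
def VanishesOnGraphs (b : V [⋀^ι]→ₗ[ℝ] ℝ) (e f : ι → V) : Prop :=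
  ∀ A : ι → ι → ℝ, (∀ i j, A i j = A j i) → b (fun i => e i + ∑ j, A i j • f j) = 0

/-- The contraction of `b` with the bivector `∑ μ, e μ ∧ f μ` vanishes. -/
def ContractsToZero (b : V [⋀^ι]→ₗ[ℝ] ℝ) (e f : ι → V) : Prop :=
  ∀ (w : ι → V) (a c : ι), a ≠ c → ∑ μ, b (update (update w a (e μ)) c (f μ)) = 0

/-- Adding multiples of one entry to all the others does not change an alternating map. -/
lemma AlternatingMap.map_add_smul_of_ne (b : V [⋀^ι]→ₗ[ℝ] ℝ) (v : ι → V) (s : ι) (r : ι → ℝ)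
    (hr : r s = 0) : b (fun a => v a + r a • v s) = b v := by
  have key : ∀ t : Finset ι, b (fun a => if a ∈ t then v a + r a • v s else v a) = b v := by
    intro t
    induction t using Finset.induction_on with
    | empty => simp
    | insert i t hi ih =>
      by_cases his : i = s
      · subst his
        rw [← ih]
        congr 1
        funext a
        by_cases ha : a = i
        · subst ha; simp [hr]
        · simp [ha]
      · rw [← ih]
        refine Eq.trans (congrArg b ?_) (AlternatingMap.map_update_add_smul b _ his (r i))
        funext a
        by_cases ha : a = i
        · subst ha; simp [hi, hr]
        · simp [ha]
  simpa using key Finset.univ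

lemma VanishesOnGraphs.swap {b : V [⋀^ι]→ₗ[ℝ] ℝ} {e f : ι → V} (h : VanishesOnGraphs b e f)
    (s : ι) : VanishesOnGraphs b (update e s (f s)) (update f s (-e s)) := by
  intro A hA
  set α : ι → ℝ := update (fun a => A a s) s 1 with hα
  set D : ι → ι → ℝ := fun a j => if a = s ∨ j = s then 0 else A a j with hD
  set r : V := ∑ j, α j • f j with hr
  set v : ι → V := fun a => e a - α a • e s + ∑ j, D a j • f j with hv
  have key : ∀ t : ℝ, b (update v s (e s - t • r)) = 0 := by
    intro t
    have h1 := h (fun a j => D a j - t * (α a * α j)) (by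
      intro i j
      simp only [hD, or_comm (a := i = s), hA i j]
      ring)
    rw [← AlternatingMap.map_add_smul_of_ne b _ s (update (fun a => -α a) s 0) (by simp)] at h1
    rw [← h1]
    congr 1
    have hrow : ∀ a, ∑ j, (D a j - t * (α a * α j)) • f j
        = ∑ j, D a j • f j - (t * α a) • r := by
      intro a
      rw [hr, Finset.smul_sum, ← Finset.sum_sub_distrib]
      refine Finset.sum_congr rfl fun j _ => ?_
      module
    funext a
    have hDs : ∑ j, D s j • f j = 0 := by simp [hD]
    have hαs : α s = 1 := by simp [hα]
    simp only [hrow]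
    by_cases ha : a = s
    · subst ha; simp [sub_eq_add_neg, hDs, hαs]
    · simp only [ne_eq, ha, not_false_eq_true, update_of_ne, hv]
      rw [hDs, hαs]
      module
  have h0 : b (update v s (e s)) = 0 := by simpa using key 0
  have h1 : b (update v s r) = 0 := by
    have := key 1
    rw [b.map_update_sub, h0] at this
    simpa using this
  have h2 : b (update v s (r - A s s • e s)) = 0 := by
    rw [b.map_update_sub, b.map_update_smul, h0, h1]; simp
  rw [← h2]
  congr 1
  funext a
  have hsum : ∑ j, A a j • update f s (-e s) j
      = -(A a s • e s) + ∑ j ∈ Finset.univ.erase s, A a j • f j := by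
    rw [← Finset.add_sum_erase _ _ (Finset.mem_univ s)]
    congr 1
    · simp
    · exact Finset.sum_congr rfl fun j hj => by rw [update_of_ne (Finset.ne_of_mem_erase hj)]
  rw [hsum]
  by_cases ha : a = s
  · subst ha
    have : r = f a + ∑ j ∈ Finset.univ.erase a, A a j • f j := by
      rw [hr, ← Finset.add_sum_erase _ _ (Finset.mem_univ a)]
      congr 1
      · simp [hα]
      · exact Finset.sum_congr rfl fun j hj => by
          rw [hα, update_of_ne (Finset.ne_of_mem_erase hj), hA]
    simp only [update_self, this]
    abel
  · have : ∑ j, D a j • f j = ∑ j ∈ Finset.univ.erase s, A a j • f j := by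
      rw [← Finset.add_sum_erase _ _ (Finset.mem_univ s)]
      have : D a s = 0 := by simp [hD]
      rw [this, zero_smul, zero_add]
      exact Finset.sum_congr rfl fun j hj => by simp [hD, ha, Finset.ne_of_mem_erase hj]
    simp only [ne_eq, ha, not_false_eq_true, update_of_ne, hv, this, hα]
    abel

lemma VanishesOnGraphs.shear {b : V [⋀^ι]→ₗ[ℝ] ℝ} {e f : ι → V} (h : VanishesOnGraphs b e f)
    {i m : ι} (him : i ≠ m) :
    VanishesOnGraphs b (update e i (e i + e m)) (update f m (f m - f i)) := by
  intro A hA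
  have hsum : ∀ a, ∑ j, A a j • update f m (f m - f i) j = ∑ j, A a j • f j - A a m • f i := by
    intro a
    rw [← Finset.add_sum_erase _ _ (Finset.mem_univ m),
      ← Finset.add_sum_erase _ (fun j => A a j • f j) (Finset.mem_univ m), update_self,
      Finset.sum_congr rfl fun j hj => by rw [update_of_ne (Finset.ne_of_mem_erase hj)]]
    module
  have h1 := h (fun a j => A a j - (if a = i then A m j else 0) - (if j = i then A a m else 0)
    + (if a = i then (if j = i then A m m else 0) else 0)) (by
      intro a j
      have h1 := hA a j
      have h2 := hA m j
      have h3 := hA a m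
      split_ifs <;> simp_all)
  rw [← AlternatingMap.map_update_add_smul b _ him (-1), ← h1]
  congr 1
  funext a
  simp only [hsum]
  by_cases ha : a = i
  · subst ha
    simp [him.symm, add_smul, sub_smul, Finset.sum_add_distrib, Finset.sum_sub_distrib, ite_smul]
    abel
  · simp [ha, sub_smul, Finset.sum_sub_distrib, ite_smul]

lemma ContractsToZero.swap {b : V [⋀^ι]→ₗ[ℝ] ℝ} {e f : ι → V} (h : ContractsToZero b e f)
    (s : ι) : ContractsToZero b (update e s (f s)) (update f s (-e s)) := by
  intro w a c hac
  rw [← h w a c hac]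
  refine Finset.sum_congr rfl fun μ _ => ?_
  by_cases hμ : μ = s
  · subst hμ
    simp only [update_self]
    rw [b.map_update_neg, ← b.map_swap _ hac]
    congr 1
    funext x
    by_cases hxa : x = a
    · subst hxa; simp [hac]
    · by_cases hxc : x = c
      · subst hxc; simp [hac]
      · simp [hxa, hxc, Equiv.swap_apply_of_ne_of_ne]
  · simp [hμ]

lemma ContractsToZero.shear {b : V [⋀^ι]→ₗ[ℝ] ℝ} {e f : ι → V} (h : ContractsToZero b e f)
    {i m : ι} (him : i ≠ m) :
    ContractsToZero b (update e i (e i + e m)) (update f m (f m - f i)) := by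
  intro w a c hac
  rw [← h w a c hac]
  have hadd : ∀ x y z, b (update (update w a (x + y)) c z)
      = b (update (update w a x) c z) + b (update (update w a y) c z) := by
    intro x y z
    simp only [update_comm hac, b.map_update_add]
  rw [← Finset.add_sum_erase _ _ (Finset.mem_univ i),
    ← Finset.add_sum_erase _ (fun μ => b (update (update w a (e μ)) c (f μ))) (Finset.mem_univ i)]
  have hm : m ∈ Finset.univ.erase i := by simp [him.symm]
  rw [← Finset.add_sum_erase _ _ hm,
    ← Finset.add_sum_erase _ (fun μ => b (update (update w a (e μ)) c (f μ))) hm]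
  rw [Finset.sum_congr rfl (g := fun μ => b (update (update w a (e μ)) c (f μ))) fun j hj => by
    rw [update_of_ne (Finset.ne_of_mem_erase hj),
      update_of_ne (Finset.ne_of_mem_erase (Finset.mem_of_mem_erase hj))]]
  simp only [update_self, update_of_ne him, update_of_ne him.symm, hadd, b.map_update_sub]
  ring

/-- An alternating form of top isotropic degree which vanishes on symmetric graphs and is killed
by the contraction with `∑ μ, e μ ∧ f μ` vanishes on all families of frame vectors. -/
theorem map_frame_eq_zero (b : V [⋀^ι]→ₗ[ℝ] ℝ) (e f : ι → V) (hG : VanishesOnGraphs b e f)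
    (hC : ContractsToZero b e f) (τ : ι → ι ⊕ ι) : b (fun a => Sum.elim e f (τ a)) = 0 := by
  induction hk : (Finset.univ.filter fun a => (τ a).isRight).card using Nat.strong_induction_on
    generalizing e f τ with
  | _ k ih =>
  subst hk
  by_cases hinj : Injective τ
  swap
  · simp only [Injective, not_forall] at hinj
    obtain ⟨x, y, hxy, hne⟩ := hinj
    exact b.map_eq_zero_of_eq _ (by simp [hxy]) hne
  by_cases hr : ∃ c i, τ c = Sum.inr i
  swap
  · have hl : ∀ a, ∃ i, τ a = Sum.inl i := by
      intro a
      cases h : τ a with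
      | inl i => exact ⟨i, rfl⟩
      | inr i => exact absurd ⟨a, i, h⟩ hr
    choose ρ hρ using hl
    have hρi : Injective ρ := fun x y hxy => hinj (by rw [hρ, hρ, hxy])
    have h0 : b e = 0 := by simpa using hG (fun _ _ => 0) (fun _ _ => rfl)
    have := b.map_perm e (Equiv.ofBijective ρ (Finite.injective_iff_bijective.1 hρi))
    rw [h0, smul_zero] at this
    rw [← this]
    congr 1
    funext a
    simp [hρ]
  obtain ⟨c, i, hc⟩ := hr
  have hlt : ∀ τ' : ι → ι ⊕ ι, (τ' c).isRight = false →
      (∀ a, (τ' a).isRight = true → (τ a).isRight = true) →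
      (Finset.univ.filter fun a => (τ' a).isRight).card
        < (Finset.univ.filter fun a => (τ a).isRight).card := by
    intro τ' h1 h2
    refine Finset.card_lt_card ((Finset.ssubset_iff_of_subset ?_).2 ⟨c, ?_, ?_⟩)
    · intro a ha
      simp only [Finset.mem_filter, Finset.mem_univ, true_and] at ha ⊢
      exact h2 a ha
    · simp [hc]
    · simp [h1]
  by_cases hl : ∃ a, τ a = Sum.inl i
  swap
  · have := ih _ (hlt (update τ c (Sum.inl i)) (by simp) (by
      intro a
      by_cases hac : a = c
      · subst hac; simp
      · simp [hac])) _ _ (hG.swap i) (hC.swap i) (update τ c (Sum.inl i)) rfl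
    rw [← this]
    congr 1
    funext a
    by_cases hac : a = c
    · subst hac; simp [hc]
    · rw [update_of_ne hac]
      cases h : τ a with
      | inl x =>
        have : x ≠ i := by rintro rfl; exact hl ⟨a, h⟩
        simp [this]
      | inr x =>
        have : x ≠ i := by rintro rfl; exact hac (hinj (h.trans hc.symm))
        simp [this]
  obtain ⟨a, ha⟩ := hl
  have hac : a ≠ c := by rintro rfl; simp [ha] at hc
  set w : ι → V := fun s => Sum.elim e f (τ s) with hw
  set T : V → V → ℝ := fun x y => b (update (update w a x) c y) with hT
  have hTw : T (e i) (f i) = b w := by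
    have h1 : e i = w a := by simp [hw, ha]
    have h2 : f i = w c := by simp [hw, hc]
    simp only [hT, h1, update_eq_self, h2]
  have hTadd : ∀ x y z, T (x + y) z = T x z + T y z := by
    intro x y z
    simp only [hT, update_comm hac, b.map_update_add]
  have hTsub : ∀ x y z, T x (y - z) = T x y - T x z := by
    intro x y z
    simp only [hT, b.map_update_sub]
  let P : ι → Prop := fun μ => ∀ s, s ≠ a → s ≠ c → τ s ≠ Sum.inl μ ∧ τ s ≠ Sum.inr μ
  have hPi : P i := fun s hsa hsc =>
    ⟨fun h => hsa (hinj (h.trans ha.symm)), fun h => hsc (hinj (h.trans hc.symm))⟩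
  have hnP : ∀ μ, ¬ P μ → T (e μ) (f μ) = 0 := by
    intro μ hμ
    simp only [P, not_forall] at hμ
    obtain ⟨s, hsa, hsc, hs⟩ := hμ
    by_cases hsl : τ s = Sum.inl μ
    · exact b.map_eq_zero_of_eq _ (i := a) (j := s) (by simp [hac, hsa, hsc, hw, hsl]) hsa.symm
    · have hsr : τ s = Sum.inr μ := by
        by_contra h
        exact hs ⟨hsl, h⟩
      exact b.map_eq_zero_of_eq _ (i := c) (j := s) (by simp [hsa, hsc, hw, hsr]) hsc.symm
  have hP : ∀ μ, P μ → T (e μ) (f μ) = b w := by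
    intro μ hμ
    by_cases hμi : μ = i
    · rw [hμi, hTw]
    have hiμ : i ≠ μ := Ne.symm hμi
    have hrest : ∀ (e' f' : ι → V), (∀ x, x ≠ i → x ≠ μ → e' x = e x ∧ f' x = f x) →
        ∀ s, s ≠ a → s ≠ c → Sum.elim e' f' (τ s) = w s := by
      intro e' f' h s hsa hsc
      have h1 := hPi s hsa hsc
      have h2 := hμ s hsa hsc
      cases hx : τ s with
      | inl x =>
        have := (h x (by rintro rfl; exact h1.1 hx) (by rintro rfl; exact h2.1 hx)).1
        simpa [hw, hx] using this
      | inr x =>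
        have := (h x (by rintro rfl; exact h1.2 hx) (by rintro rfl; exact h2.2 hx)).2
        simpa [hw, hx] using this
    have hstep : ∀ (e' f' : ι → V), VanishesOnGraphs b e' f' → ContractsToZero b e' f' →
        (∀ x, x ≠ i → x ≠ μ → e' x = e x ∧ f' x = f x) →
        ∀ x y, T (e' x) (e' y) = 0 := by
      intro e' f' hG' hC' h x y
      rw [← ih _ (hlt (update (update τ a (Sum.inl x)) c (Sum.inl y)) (by simp) (by
        intro s
        by_cases hsc : s = c
        · subst hsc; simp
        · by_cases hsa : s = a
          · subst hsa; simp [hac]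
          · simp [hsa, hsc])) e' f' hG' hC' _ rfl]
      simp only [hT]
      congr 1
      funext s
      by_cases hsc : s = c
      · subst hsc; simp
      · by_cases hsa : s = a
        · subst hsa; simp [hac]
        · simp [hsa, hsc, hrest e' f' h s hsa hsc]
    have h1 := hstep _ _ ((hG.shear hiμ).swap μ) ((hC.shear hiμ).swap μ)
      (fun x hxi hxμ => by simp [hxi, hxμ]) i μ
    have h2 := hstep _ _ (hG.swap μ) (hC.swap μ) (fun x _ hxμ => by simp [hxμ]) i μ
    have h3 := hstep _ _ (hG.swap i) (hC.swap i) (fun x hxi _ => by simp [hxi]) μ i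
    simp only [update_self, update_of_ne hiμ, update_of_ne hμi] at h1 h2 h3
    rw [hTadd, hTsub, hTsub, h2, h3, hTw] at h1
    linarith
  classical
  have hsum : ∑ μ, T (e μ) (f μ) = 0 := hC w a c hac
  rw [Finset.sum_congr rfl (g := fun μ => if P μ then b w else 0) fun μ _ => by
    split_ifs with h
    · exact hP μ h
    · exact hnP μ h, ← Finset.sum_filter, Finset.sum_const, nsmul_eq_mul] at hsum
  refine (mul_eq_zero.1 hsum).resolve_left ?_
  exact Nat.cast_ne_zero.2 (Finset.card_ne_zero_of_mem (a := i) (by simp [hPi]))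

end Frames

section Jets

open Function

/-- A quadratic function with prescribed value, gradient and Hessian at a point. -/
def quadJet {n : ℕ} (x : Vec n) (u : ℝ) (p : Vec n) (A : Fin n → Fin n → ℝ) (y : Vec n) : ℝ :=
  u + ∑ j, p j * (y j - x j) + 2⁻¹ * ∑ i, ∑ j, A i j * ((y i - x i) * (y j - x j))

lemma contDiff_quadJet {n : ℕ} (x : Vec n) (u : ℝ) (p : Vec n) (A : Fin n → Fin n → ℝ) :
    ContDiff ℝ (⊤ : ℕ∞) (quadJet x u p A) := by
  unfold quadJet
  fun_prop

lemma fderiv_quadJet {n : ℕ} (x : Vec n) (u : ℝ) (p : Vec n) (A : Fin n → Fin n → ℝ)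
    (hA : ∀ i j, A i j = A j i) (y v : Vec n) :
    fderiv ℝ (quadJet x u p A) y v = ∑ j, (p j + ∑ i, A i j * (y i - x i)) * v j := by
  have hc : ∀ i : Fin n, HasFDerivAt (fun y : Vec n => y i - x i)
      (ContinuousLinearMap.proj (R := ℝ) (φ := fun _ : Fin n => ℝ) i) y := fun i =>
    (hasFDerivAt_apply i y).sub_const (x i)
  have h : HasFDerivAt (quadJet x u p A) _ y :=
    ((HasFDerivAt.fun_sum fun j (_ : j ∈ Finset.univ) => (hc j).const_mul (p j)).const_add u).add
      ((HasFDerivAt.fun_sum fun i (_ : i ∈ Finset.univ) =>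
        HasFDerivAt.fun_sum fun j (_ : j ∈ Finset.univ) =>
          ((hc i).mul (hc j)).const_mul (A i j)).const_mul 2⁻¹)
  rw [h.fderiv]
  simp only [_root_.add_apply, _root_.sum_apply,
    _root_.smul_apply, ContinuousLinearMap.proj_apply, smul_eq_mul, mul_add, add_mul,
    Finset.sum_add_distrib]
  have h1 : ∑ i, ∑ j, A i j * ((y i - x i) * v j) = ∑ j, (∑ i, A i j * (y i - x i)) * v j := by
    rw [Finset.sum_comm]
    refine Finset.sum_congr rfl fun j _ => ?_
    rw [Finset.sum_mul]
    exact Finset.sum_congr rfl fun i _ => by ring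
  have h2 : ∑ i, ∑ j, A i j * ((y j - x j) * v i) = ∑ j, (∑ i, A i j * (y i - x i)) * v j := by
    refine Finset.sum_congr rfl fun j _ => ?_
    rw [Finset.sum_mul]
    exact Finset.sum_congr rfl fun i _ => by rw [hA]; ring
  rw [h1, h2]
  ring

lemma index_cases {n : ℕ} (k : Fin (2 * n + 1)) :
    (∃ i, k = qIdx i) ∨ k = uIdx ∨ ∃ i, k = pIdx i := by
  rcases lt_trichotomy (k : ℕ) n with h | h | h
  · exact Or.inl ⟨⟨k, h⟩, rfl⟩
  · exact Or.inr (Or.inl (Fin.ext h))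
  · refine Or.inr (Or.inr ⟨⟨k - (n + 1), by omega⟩, Fin.ext ?_⟩)
    simp only [pIdx]
    omega

lemma jet_qIdx {n : ℕ} (φ : Vec n → ℝ) (x : Vec n) (i : Fin n) : jet φ x (qIdx i) = x i := by
  simp [jet, qIdx]

lemma jet_uIdx {n : ℕ} (φ : Vec n → ℝ) (x : Vec n) : jet φ x uIdx = φ x := by
  simp [jet, uIdx]

lemma jet_pIdx {n : ℕ} (φ : Vec n → ℝ) (x : Vec n) (i : Fin n) :
    jet φ x (pIdx i) = fderiv ℝ φ x (basisVec i) := by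
  have h1 : ¬ n + 1 + (i : ℕ) < n := by omega
  have h2 : ¬ n + 1 + (i : ℕ) = n := by omega
  simp [jet, pIdx, h1, h2]

lemma qIdx_inj {n : ℕ} {i j : Fin n} : qIdx i = qIdx j ↔ i = j := by
  simp [qIdx, Fin.ext_iff]

lemma pIdx_inj {n : ℕ} {i j : Fin n} : pIdx i = pIdx j ↔ i = j := by
  simp [pIdx, Fin.ext_iff]

lemma qIdx_ne_pIdx {n : ℕ} (i j : Fin n) : qIdx i ≠ pIdx j := by
  simp only [qIdx, pIdx, ne_eq, Fin.mk.injEq]; omega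

lemma qIdx_ne_uIdx {n : ℕ} (i : Fin n) : qIdx i ≠ uIdx := by
  simp only [qIdx, uIdx, ne_eq, Fin.mk.injEq]; omega

lemma pIdx_ne_uIdx {n : ℕ} (i : Fin n) : pIdx i ≠ uIdx := by
  simp only [pIdx, uIdx, ne_eq, Fin.mk.injEq]; omega

lemma fderiv_quadJet_basisVec {n : ℕ} (x : Vec n) (u : ℝ) (p : Vec n) (A : Fin n → Fin n → ℝ)
    (hA : ∀ i j, A i j = A j i) (y : Vec n) (j : Fin n) :
    fderiv ℝ (quadJet x u p A) y (basisVec j) = p j + ∑ i, A i j * (y i - x i) := by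
  rw [fderiv_quadJet x u p A hA]
  simp [basisVec, Pi.single_apply]

lemma jet_quadJet {n : ℕ} (z : Vec (2 * n + 1)) (A : Fin n → Fin n → ℝ)
    (hA : ∀ i j, A i j = A j i) :
    jet (quadJet (fun i => z (qIdx i)) (z uIdx) (fun i => z (pIdx i)) A) (fun i => z (qIdx i))
      = z := by
  funext k
  rcases index_cases k with ⟨i, rfl⟩ | rfl | ⟨i, rfl⟩
  · rw [jet_qIdx]
  · rw [jet_uIdx]; simp [quadJet]
  · rw [jet_pIdx, fderiv_quadJet_basisVec _ _ _ _ hA]; simp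

lemma fderiv_jet_quadJet {n : ℕ} (z : Vec (2 * n + 1)) (A : Fin n → Fin n → ℝ)
    (hA : ∀ i j, A i j = A j i) (i : Fin n) :
    fderiv ℝ (jet (quadJet (fun i => z (qIdx i)) (z uIdx) (fun i => z (pIdx i)) A))
        (fun i => z (qIdx i)) (basisVec i)
      = basisVec (qIdx i) + ∑ j, A i j • basisVec (pIdx j) + z (pIdx i) • chi := by
  set x : Vec n := fun i => z (qIdx i) with hx
  set φ := quadJet x (z uIdx) (fun i => z (pIdx i)) A with hφ
  have hφd : Differentiable ℝ φ := (contDiff_quadJet _ _ _ _).differentiable (by simp)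
  have hd : ∀ k, DifferentiableAt ℝ (fun y => jet φ y k) x := by
    intro k
    rcases index_cases k with ⟨i, rfl⟩ | rfl | ⟨i, rfl⟩
    · simp only [jet_qIdx]; fun_prop
    · simp only [jet_uIdx]; exact hφd x
    · simp only [jet_pIdx, hφ, fderiv_quadJet_basisVec _ _ _ _ hA]; fun_prop
  funext k
  rw [fderiv_pi hd]
  simp only [ContinuousLinearMap.pi_apply, Pi.add_apply, Finset.sum_apply, Pi.smul_apply,
    smul_eq_mul, chi, basisVec]
  rcases index_cases k with ⟨j, rfl⟩ | rfl | ⟨j, rfl⟩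
  · simp only [jet_qIdx]
    rw [(hasFDerivAt_apply j x).fderiv]
    simp [Pi.single_apply, qIdx_inj, qIdx_ne_pIdx, qIdx_ne_uIdx]
  · simp only [jet_uIdx]
    have := fderiv_quadJet_basisVec x (z uIdx) (fun i => z (pIdx i)) A hA x i
    rw [basisVec] at this
    rw [hφ, this]
    simp [(qIdx_ne_uIdx _).symm, (pIdx_ne_uIdx _).symm]
  · simp only [jet_pIdx, hφ, fderiv_quadJet_basisVec _ _ _ _ hA]
    have h : HasFDerivAt (fun y : Vec n => z (pIdx j) + ∑ l, A l j * (y l - x l)) _ x :=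
      (HasFDerivAt.fun_sum fun l (_ : l ∈ Finset.univ) =>
        ((hasFDerivAt_apply (𝕜 := ℝ) l x).sub_const (x l)).const_mul (A l j)).const_add _
    rw [h.fderiv]
    simp [Pi.single_apply, pIdx_inj, (qIdx_ne_pIdx _ _).symm, pIdx_ne_uIdx]

end Jets

section Effective

open Function

variable {n : ℕ}

/-- An alternating map killed by the insertion of `u` is insensitive to multiples of `u`. -/
lemma AlternatingMap.map_add_smul_of_kills {ι V : Type*} [Fintype ι] [DecidableEq ι]
    [AddCommGroup V] [Module ℝ V] (b : V [⋀^ι]→ₗ[ℝ] ℝ) {u : V}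
    (hu : ∀ w s, b (update w s u) = 0) (v : ι → V) (r : ι → ℝ) :
    b (fun a => v a + r a • u) = b v := by
  have key : ∀ t : Finset ι, b (fun a => if a ∈ t then v a + r a • u else v a) = b v := by
    intro t
    induction t using Finset.induction_on with
    | empty => simp
    | insert i t hi ih =>
      rw [← ih]
      have : (fun a => if a ∈ insert i t then v a + r a • u else v a)
          = update (fun a => if a ∈ t then v a + r a • u else v a) i (v i + r i • u) := by
        funext a
        by_cases ha : a = i
        · subst ha; simp
        · simp [ha]
      rw [this, b.map_update_add, b.map_update_smul, hu, smul_zero, add_zero]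
      congr 1
      funext a
      by_cases ha : a = i
      · subst ha; simp [hi]
      · simp [ha]
  simpa using key Finset.univ

lemma Effective.map_update_chi {ω : Form (2 * n + 1) n} (heff : Effective ω)
    {z : Vec (2 * n + 1)} {a : Vec (2 * n + 1) [⋀^Fin n]→ₗ[ℝ] ℝ} (ha : ∀ v, ω z v = a v)
    (w : Fin n → Vec (2 * n + 1)) (s : Fin n) : a (update w s chi) = 0 := by
  obtain _ | k := n
  · exact s.elim0
  have h := congrFun (congrFun heff.1 z) fun i => update w s chi (Equiv.swap 0 s i.succ)
  have h' : a (Fin.cons chi fun i => update w s chi (Equiv.swap 0 s i.succ)) = 0 := by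
    rw [← ha]; exact h
  have hperm : (Fin.cons chi fun i => update w s chi (Equiv.swap 0 s i.succ))
      = update w s chi ∘ Equiv.swap 0 s := by
    funext i
    refine Fin.cases ?_ (fun i => ?_) i <;> simp
  rw [hperm, a.map_perm, smul_eq_zero_iff_eq] at h'
  exact h'

lemma Effective.contractsToZero {ω : Form (2 * n + 1) n} (heff : Effective ω)
    {z : Vec (2 * n + 1)} {a : Vec (2 * n + 1) [⋀^Fin n]→ₗ[ℝ] ℝ} (ha : ∀ v, ω z v = a v) :
    ContractsToZero a (fun i => basisVec (qIdx i)) (fun i => basisVec (pIdx i)) := by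
  intro w s t hst
  obtain _ | _ | k := n
  · exact s.elim0
  · omega
  obtain ⟨σ, hσ0, hσ1⟩ : ∃ σ : Equiv.Perm (Fin (k + 2)), σ 0 = s ∧ σ 1 = t := by
    refine ⟨Equiv.swap 0 s * Equiv.swap 1 (Equiv.swap 0 s t), ?_, ?_⟩
    · rw [Equiv.Perm.mul_apply, Equiv.swap_apply_of_ne_of_ne zero_ne_one, Equiv.swap_apply_left]
      intro h
      have := congrArg (Equiv.swap 0 s) h
      simp at this
      exact hst this
    · simp
  have hperm : ∀ x y : Vec (2 * (k + 2) + 1), a (update (update w s x) t y)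
      = Equiv.Perm.sign σ • a (Fin.cons x (Fin.cons y fun i => w (σ i.succ.succ))) := by
    intro x y
    have : (Fin.cons x (Fin.cons y fun i => w (σ i.succ.succ)) : Fin (k + 2) → _)
        = update (update w s x) t y ∘ σ := by
      funext i
      refine Fin.cases ?_ (fun i => Fin.cases ?_ (fun i => ?_) i) i
      · simp [hσ0, hst]
      · simp [hσ1]
      · have h1 : σ i.succ.succ ≠ t := by
          rw [← hσ1, ne_eq, σ.injective.eq_iff, ← Fin.succ_zero_eq_one, Fin.succ_inj]
          exact Fin.succ_ne_zero i
        have h0 : σ i.succ.succ ≠ s := by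
          rw [← hσ0, ne_eq, σ.injective.eq_iff]
          exact Fin.succ_ne_zero _
        simp [h1, h0]
    rw [this, a.map_perm, smul_smul, Int.units_mul_self, one_smul]
  simp only [hperm]
  rw [← Finset.smul_sum]
  have h := congrFun (congrFun heff.2 z) fun i => w (σ i.succ.succ)
  simp only [← ha]
  rw [smul_eq_zero_iff_eq]
  rw [botOp, Finset.sum_apply, Finset.sum_apply] at h
  exact h

/-- The horizontal volume form as an alternating map. -/
def qvolAlt (n : ℕ) : Vec (2 * n + 1) [⋀^Fin n]→ₗ[ℝ] ℝ :=
  Matrix.detRowAlternating.compLinearMap (LinearMap.funLeft ℝ ℝ qIdx)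

lemma qvolAlt_eq_zero (v : Fin n → Vec (2 * n + 1)) (s : Fin n) (h : ∀ j, v s (qIdx j) = 0) :
    qvolAlt n v = 0 :=
  Matrix.det_eq_zero_of_row_eq_zero s h

lemma qvolAlt_eq_one (v : Fin n → Vec (2 * n + 1))
    (h : ∀ i j, v i (qIdx j) = if i = j then 1 else 0) : qvolAlt n v = 1 := by
  have : (Matrix.of fun i j : Fin n => v i (qIdx j)) = 1 := by
    ext i j
    simp [h, Matrix.one_apply]
  exact (congrArg Matrix.det this).trans Matrix.det_one

end Effective

/-- an effective n-form on ℝ^{2n+1} whose Monge–Ampère operator is of first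
order, `(j¹φ)*ω = (F ∘ j¹φ)·β` for all smooth `φ`, is of the form `ω = L·β`
(indeed `ω = F·β`). -/
theorem effective_first_order_lagrangian (n : ℕ) (ω : Form (2 * n + 1) n)
    (hω : IsForm ω) (hωs : SmoothForm ω) (heff : Effective ω)
    (F : Vec (2 * n + 1) → ℝ) (hF : ContDiff ℝ (⊤ : ℕ∞) F)
    (hfo : ∀ φ : Vec n → ℝ, ContDiff ℝ (⊤ : ℕ∞) φ →
      pullback (jet φ) ω = fsmul (fun x => F (jet φ x)) baseVol) :
    ω = fsmul F qvol := by
  funext z v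
  obtain ⟨a, ha⟩ := hω z
  set b : Vec (2 * n + 1) [⋀^Fin n]→ₗ[ℝ] ℝ := a - F z • qvolAlt n with hb
  suffices h : b = 0 by
    rw [ha, sub_eq_zero.1 h]
    rfl
  have hu : ∀ w s, b (Function.update w s chi) = 0 := by
    intro w s
    have h : qvolAlt n (Function.update w s chi) = 0 :=
      qvolAlt_eq_zero _ s fun j => by simp [chi, basisVec, qIdx_ne_uIdx]
    simp [hb, heff.map_update_chi ha, h]
  have hC : ContractsToZero b (fun i => basisVec (qIdx i)) (fun i => basisVec (pIdx i)) := by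
    intro w s t hst
    rw [← heff.contractsToZero ha w s t hst]
    refine Finset.sum_congr rfl fun μ _ => ?_
    have h : qvolAlt n (Function.update (Function.update w s (basisVec (qIdx μ))) t
        (basisVec (pIdx μ))) = 0 :=
      qvolAlt_eq_zero _ t fun j => by simp [basisVec, qIdx_ne_pIdx]
    simp [hb, h]
  have hG : VanishesOnGraphs b (fun i => basisVec (qIdx i)) (fun i => basisVec (pIdx i)) := by
    intro A hA
    rw [← AlternatingMap.map_add_smul_of_kills b hu _ fun i => z (pIdx i)]
    have h := congrFun (congrFun (hfo _ (contDiff_quadJet (fun i => z (qIdx i)) (z uIdx)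
      (fun i => z (pIdx i)) A)) fun i => z (qIdx i)) basisVec
    simp only [pullback, fsmul, jet_quadJet z A hA, fderiv_jet_quadJet z A hA, ha] at h
    have hone : (Matrix.of fun i j : Fin n => (basisVec i : Vec n) j) = 1 := by
      ext i j
      simp [basisVec, Matrix.one_apply, Pi.single_apply, eq_comm]
    rw [baseVol, hone, Matrix.det_one, mul_one] at h
    rw [hb, AlternatingMap.sub_apply, AlternatingMap.smul_apply, h, qvolAlt_eq_one, smul_eq_mul,
      mul_one, sub_self]
    intro i j
    simp [chi, basisVec, Pi.single_apply, qIdx_inj, qIdx_ne_pIdx, qIdx_ne_uIdx, @eq_comm _ j]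
  refine Module.Basis.ext_alternating (Pi.basisFun ℝ (Fin (2 * n + 1))) fun k _ => ?_
  simp only [Pi.basisFun_apply, AlternatingMap.zero_apply]
  by_cases hk : ∃ s, k s = uIdx
  · obtain ⟨s, hs⟩ := hk
    rw [← hu (fun i => Pi.single (k i) 1) s]
    congr 1
    funext i
    by_cases hi : i = s
    · subst hi; simp [hs, chi, basisVec]
    · simp [hi]
  · have hτ : ∀ i, ∃ l : Fin n ⊕ Fin n, (Pi.single (k i) 1 : Vec (2 * n + 1))
        = Sum.elim (fun i => basisVec (qIdx i)) (fun i => basisVec (pIdx i)) l := by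
      intro i
      rcases index_cases (k i) with ⟨j, hj⟩ | hj | ⟨j, hj⟩
      · exact ⟨Sum.inl j, by rw [hj]; rfl⟩
      · exact absurd ⟨i, hj⟩ hk
      · exact ⟨Sum.inr j, by rw [hj]; rfl⟩
    choose τ hτ using hτ
    simp only [hτ]
    exact map_frame_eq_zero b _ _ hG hC τ

end MA
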